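/- arXiv:2408.12512 — 9 statements merged into one kernel-verified Lean document; each statement's English description precedes it below -/
import Mathlib

section
/- Let ν > 0, γ ≥ 0, d ≥ 0 be real numbers, set σ = √(d² + ν⁻¹), and let 0 < a ≤ b be real numbers. Then 1 + γ(σ·coth(b) − d) < ν·(σ·coth(a) + d)·(σ·coth(b) + d + γ·ν⁻¹). -/
noncomputable def coth (x : ℝ) : ℝ := Real.cosh x / Real.sinh x

theorem sd1_diff_negative (ν γ d a b : ℝ) (hν : 0 < ν) (hγ : 0 ≤ γ) (hd : 0 ≤ d)
    (ha : 0 < a) (hab : a ≤ b) :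
    1 + γ * (Real.sqrt (d ^ 2 + ν⁻¹) * coth b - d) <
      ν * (Real.sqrt (d ^ 2 + ν⁻¹) * coth a + d) *
        (Real.sqrt (d ^ 2 + ν⁻¹) * coth b + d + γ * ν⁻¹) := by
  have hsa : 0 < Real.sinh a := Real.sinh_pos_iff.2 ha
  have hsb : 0 < Real.sinh b := Real.sinh_pos_iff.2 (lt_of_lt_of_le ha hab)
  have hB : 1 < coth b := by
    unfold coth
    rw [lt_div_iff₀ hsb, one_mul]
    exact Real.sinh_lt_cosh b
  have hBA : coth b ≤ coth a := by
    unfold coth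
    rw [div_le_div_iff₀ hsb hsa]
    have h : 0 ≤ Real.sinh (b - a) := Real.sinh_nonneg_iff.2 (sub_nonneg.2 hab)
    rw [Real.sinh_sub] at h
    linarith
  have hi : 0 < ν⁻¹ := inv_pos.2 hν
  have hp : 0 < d ^ 2 + ν⁻¹ := by positivity
  have hs : 0 < Real.sqrt (d ^ 2 + ν⁻¹) := Real.sqrt_pos.2 hp
  have hsq : Real.sqrt (d ^ 2 + ν⁻¹) ^ 2 = d ^ 2 + ν⁻¹ := Real.sq_sqrt hp.le
  generalize Real.sqrt (d ^ 2 + ν⁻¹) = s at *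
  generalize coth a = A at *
  generalize coth b = B at *
  have hνi : ν * ν⁻¹ = 1 := mul_inv_cancel₀ hν.ne'
  have h1 : s < s * B + d := by nlinarith
  have h2 : s * B + d ≤ s * A + d := by nlinarith
  have h3 : s ^ 2 < (s * A + d) * (s * B + d) := by nlinarith
  have h4 : 1 < ν * ((s * A + d) * (s * B + d)) := by
    have := mul_lt_mul_of_pos_left h3 hν
    have h5 : 0 ≤ ν * d ^ 2 := by positivity
    rw [hsq, mul_add, hνi] at this
    linarith
  have h6 : γ * (s * B - d) ≤ γ * (s * A + d) :=
    mul_le_mul_of_nonneg_left (by linarith) hγ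
  have h7 : ν * (s * A + d) * (s * B + d + γ * ν⁻¹)
      = ν * ((s * A + d) * (s * B + d)) + (ν * ν⁻¹) * (γ * (s * A + d)) := by ring
  rw [h7, hνi]
  linarith
end

section
/- Let ν > 0, γ ≥ 0, 0 < α < T, and d ≥ 0 be real numbers; set σ = √(d² + ν⁻¹), a = σα, b = σ(T − α). If α ≤ T/2 or γ = 0, then the convergence factor expression of the Schwarz algorithm SD₁ satisfies (1 + γ(σ·coth(b) − d)) / (ν·(σ·coth(a) + d)·(σ·coth(b) + d + γ·ν⁻¹)) < 1. -/
theorem one_lt_coth_aux {x : ℝ} (hx : 0 < x) : 1 < coth x := by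
  unfold coth
  rw [one_lt_div (Real.sinh_pos_iff.2 hx)]
  exact Real.sinh_lt_cosh x

theorem coth_anti_aux {x y : ℝ} (hx : 0 < x) (hxy : x ≤ y) : coth y ≤ coth x := by
  unfold coth
  rw [div_le_div_iff₀ (Real.sinh_pos_iff.2 (hx.trans_le hxy)) (Real.sinh_pos_iff.2 hx)]
  have h : 0 ≤ Real.sinh (y - x) := Real.sinh_nonneg_iff.2 (by linarith)
  rw [Real.sinh_sub] at h
  linarith

theorem sd1_convergence (ν γ α T d : ℝ) (hν : 0 < ν) (hγ : 0 ≤ γ)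
    (hα : 0 < α) (hαT : α < T) (hd : 0 ≤ d)
    (h : α ≤ T / 2 ∨ γ = 0) :
    (1 + γ * (Real.sqrt (d ^ 2 + ν⁻¹) * coth (Real.sqrt (d ^ 2 + ν⁻¹) * (T - α)) - d)) /
      (ν * (Real.sqrt (d ^ 2 + ν⁻¹) * coth (Real.sqrt (d ^ 2 + ν⁻¹) * α) + d) *
        (Real.sqrt (d ^ 2 + ν⁻¹) * coth (Real.sqrt (d ^ 2 + ν⁻¹) * (T - α)) + d + γ * ν⁻¹)) < 1 := by
  have hn : 0 < ν⁻¹ := inv_pos.2 hν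
  have hs2 : Real.sqrt (d ^ 2 + ν⁻¹) ^ 2 = d ^ 2 + ν⁻¹ := Real.sq_sqrt (by positivity)
  have hs : 0 < Real.sqrt (d ^ 2 + ν⁻¹) := Real.sqrt_pos.2 (by positivity)
  generalize Real.sqrt (d ^ 2 + ν⁻¹) = s at *
  have hb : 0 < T - α := by linarith
  have hX : s < s * coth (s * α) :=
    lt_mul_of_one_lt_right hs (one_lt_coth_aux (mul_pos hs hα))
  have hY : s < s * coth (s * (T - α)) :=
    lt_mul_of_one_lt_right hs (one_lt_coth_aux (mul_pos hs hb))
  have hXY : γ * (s * coth (s * (T - α))) ≤ γ * (s * coth (s * α)) := by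
    rcases h with h | h
    · refine mul_le_mul_of_nonneg_left (mul_le_mul_of_nonneg_left
        (coth_anti_aux (mul_pos hs hα) (mul_le_mul_of_nonneg_left ?_ hs.le)) hs.le) hγ
      linarith
    · simp [h]
  generalize s * coth (s * α) = X at *
  generalize s * coth (s * (T - α)) = Y at *
  have hXd : 0 < X + d := by linarith
  have hYd : 0 < Y + d := by linarith
  have hg : 0 ≤ γ * ν⁻¹ := by positivity
  rw [div_lt_one (by positivity)]
  have e : ν * (X + d) * (Y + d + γ * ν⁻¹) = ν * ((X + d) * (Y + d)) + γ * (X + d) := by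
    field_simp
  rw [e]
  have h1 : ν⁻¹ < (X + d) * (Y + d) := by
    have h2 : s * s < (X + d) * (Y + d) :=
      mul_lt_mul'' (by linarith) (by linarith) hs.le hs.le
    nlinarith [sq_nonneg d]
  have h3 : 1 < ν * ((X + d) * (Y + d)) := by
    have := mul_lt_mul_of_pos_left h1 hν
    rwa [mul_inv_cancel₀ hν.ne'] at this
  have h4 : 0 ≤ γ * d := mul_nonneg hγ hd
  nlinarith
end

section
/- Let ν > 0 and 0 < α < T. The function f : [0, ∞) → ℝ defined by f(d) = 1 / (ν·(σ(d)·coth(σ(d)·α) + d)·(σ(d)·coth(σ(d)·(T − α)) + d)), where σ(d) = √(d² + ν⁻¹), is strictly decreasing on [0, ∞). -/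
lemma sinh_convex_aux : ConvexOn ℝ (Set.Ici 0) Real.sinh := by
  refine convexOn_of_deriv2_nonneg (convex_Ici 0) Real.continuous_sinh.continuousOn
    Real.differentiable_sinh.differentiableOn ?_ ?_
  · rw [Real.deriv_sinh]; exact Real.differentiable_cosh.differentiableOn
  · intro x hx
    rw [interior_Ici] at hx
    simp only [Function.iterate_succ, Function.iterate_zero, Function.comp, id, Real.deriv_sinh,
      Real.deriv_cosh]
    exact Real.sinh_nonneg_iff.2 (le_of_lt hx)

lemma sinh_ratio_aux (u v : ℝ) (hu : 0 ≤ u) (huv : u ≤ v) (hv : 0 < v) :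
    v * Real.sinh u ≤ u * Real.sinh v := by
  have h1 : 0 ≤ 1 - u / v := by rw [sub_nonneg, div_le_one hv]; exact huv
  have h2 : 0 ≤ u / v := by positivity
  have h := sinh_convex_aux.2 (Set.mem_Ici.2 le_rfl) (Set.mem_Ici.2 hv.le) h1 h2 (by ring)
  simp only [smul_eq_mul, Real.sinh_zero, mul_zero, zero_add, div_mul_cancel₀ u hv.ne'] at h
  calc v * Real.sinh u ≤ v * (u / v * Real.sinh v) := by gcongr
    _ = u * Real.sinh v := by field_simp

lemma coth_mono_aux (s t a : ℝ) (hs : 0 < s) (hst : s ≤ t) (ha : 0 < a) :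
    s * coth (s * a) ≤ t * coth (t * a) := by
  have ht : 0 < t := hs.trans_le hst
  have h1 : 0 < Real.sinh (s * a) := Real.sinh_pos_iff.2 (by positivity)
  have h2 : 0 < Real.sinh (t * a) := Real.sinh_pos_iff.2 (by positivity)
  have hm : s * a ≤ t * a := by gcongr
  have hsa : 0 < s * a := by positivity
  have h := sinh_ratio_aux (t * a - s * a) (t * a + s * a) (by linarith) (by linarith) (by linarith)
  rw [Real.sinh_sub, Real.sinh_add] at h
  unfold coth
  rw [← mul_div_assoc, ← mul_div_assoc, div_le_div_iff₀ h1 h2]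
  refine le_of_mul_le_mul_left ?_ ha
  nlinarith [h]

lemma coth_pos_aux (x : ℝ) (hx : 0 < x) : 0 < coth x :=
  div_pos (Real.cosh_pos x) (Real.sinh_pos_iff.2 hx)

theorem sd1_factor_strictAnti (ν α T : ℝ) (hν : 0 < ν) (hα : 0 < α) (hαT : α < T) :
    StrictAntiOn (fun d : ℝ =>
      1 / (ν * (Real.sqrt (d ^ 2 + ν⁻¹) * coth (Real.sqrt (d ^ 2 + ν⁻¹) * α) + d) *
        (Real.sqrt (d ^ 2 + ν⁻¹) * coth (Real.sqrt (d ^ 2 + ν⁻¹) * (T - α)) + d)))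
      (Set.Ici 0) := by
  intro x hx y hy hxy
  have hx0 : 0 ≤ x := hx
  have hb : 0 < T - α := sub_pos.2 hαT
  have hs : 0 < Real.sqrt (x ^ 2 + ν⁻¹) := Real.sqrt_pos.2 (by positivity)
  have hst : Real.sqrt (x ^ 2 + ν⁻¹) ≤ Real.sqrt (y ^ 2 + ν⁻¹) := by
    apply Real.sqrt_le_sqrt; gcongr
  have m1 := coth_mono_aux _ _ α hs hst hα
  have m2 := coth_mono_aux _ _ (T - α) hs hst hb
  have p1 := mul_pos hs (coth_pos_aux _ (mul_pos hs hα))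
  have p2 := mul_pos hs (coth_pos_aux _ (mul_pos hs hb))
  have q1 := add_pos_of_pos_of_nonneg p1 hx0
  have q2 := add_pos_of_pos_of_nonneg p2 hx0
  have l1 := add_lt_add_of_le_of_lt m1 hxy
  have l2 := add_lt_add_of_le_of_lt m2 hxy
  refine one_div_lt_one_div_of_lt (mul_pos (mul_pos hν q1) q2) ?_
  exact mul_lt_mul'' (mul_lt_mul_of_pos_left l1 hν) l2 (mul_pos hν q1).le q2.le
end

section
/- Let ν > 0, γ ≥ 0 and 0 < α < T be fixed. Define for d > 0: ρ(d) = (1 + γ(σ(d)·coth(σ(d)·(T − α)) − d)) / (ν·(σ(d)·coth(σ(d)·α) + d)·(σ(d)·coth(σ(d)·(T − α)) + d + γ·ν⁻¹)), where σ(d) = √(d² + ν⁻¹). Then 4·ν·d²·ρ(d) tends to 1 as d → ∞. -/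
open Filter in
theorem sd1_aux (c a : ℝ) (hc : 0 < c) (ha : 0 < a) :
    Tendsto (fun d : ℝ => Real.sqrt (d ^ 2 + c) * coth (Real.sqrt (d ^ 2 + c) * a) - d)
      atTop (nhds 0) := by
  have hlim : Tendsto (fun d : ℝ => Real.exp (-(d * a)) / a + c / d) atTop (nhds 0) := by
    have h1 : Tendsto (fun d : ℝ => Real.exp (-(d * a))) atTop (nhds 0) :=
      Real.tendsto_exp_neg_atTop_nhds_zero.comp (tendsto_id.atTop_mul_const ha)
    have h2 : Tendsto (fun d : ℝ => c / d) atTop (nhds 0) :=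
      tendsto_const_nhds.div_atTop tendsto_id
    simpa using (h1.div_const a).add h2
  refine tendsto_of_tendsto_of_tendsto_of_le_of_le' tendsto_const_nhds hlim ?_ ?_ <;>
    filter_upwards [eventually_gt_atTop 0] with d hd
  all_goals
    have hs1 : d ≤ Real.sqrt (d ^ 2 + c) := Real.le_sqrt_of_sq_le (by linarith)
    have hs2 : Real.sqrt (d ^ 2 + c) ≤ d + c / d := by
      apply Real.sqrt_le_iff.2
      refine ⟨by positivity, ?_⟩
      have : (d + c / d) ^ 2 = d ^ 2 + 2 * c + (c / d) ^ 2 := by field_simp; ring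
      rw [this]
      nlinarith [sq_nonneg (c / d)]
    generalize Real.sqrt (d ^ 2 + c) = s at *
    have hs : 0 < s := by linarith
    have hx : 0 < s * a := by positivity
    have hsh : 0 < Real.sinh (s * a) := Real.sinh_pos_iff.2 hx
    have hco : s * coth (s * a) = s + s * (Real.exp (-(s * a)) / Real.sinh (s * a)) := by
      unfold coth
      rw [← Real.cosh_sub_sinh]
      field_simp
      ring
    rw [hco]
  · have : 0 ≤ s * (Real.exp (-(s * a)) / Real.sinh (s * a)) := by positivity
    linarith
  · have h3 : s * a ≤ Real.sinh (s * a) := Real.self_le_sinh_iff.2 hx.le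
    have h4 : s * (Real.exp (-(s * a)) / Real.sinh (s * a)) ≤ Real.exp (-(d * a)) / a := by
      calc _ ≤ s * (Real.exp (-(s * a)) / (s * a)) := by gcongr
        _ = Real.exp (-(s * a)) / a := by field_simp
        _ ≤ _ := by gcongr
    linarith

theorem sd1_factor_asymptotic (ν γ α T : ℝ) (hν : 0 < ν) (hγ : 0 ≤ γ)
    (hα : 0 < α) (hαT : α < T) :
    Filter.Tendsto (fun d : ℝ =>
      4 * ν * d ^ 2 *
        ((1 + γ * (Real.sqrt (d ^ 2 + ν⁻¹) * coth (Real.sqrt (d ^ 2 + ν⁻¹) * (T - α)) - d)) /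
          (ν * (Real.sqrt (d ^ 2 + ν⁻¹) * coth (Real.sqrt (d ^ 2 + ν⁻¹) * α) + d) *
            (Real.sqrt (d ^ 2 + ν⁻¹) * coth (Real.sqrt (d ^ 2 + ν⁻¹) * (T - α)) + d + γ * ν⁻¹))))
      Filter.atTop (nhds 1) := by
  have hA := sd1_aux ν⁻¹ α (inv_pos.2 hν) hα
  have hB := sd1_aux ν⁻¹ (T - α) (inv_pos.2 hν) (sub_pos.2 hαT)
  have hA2 := hA.div_atTop Filter.tendsto_id
  have hB2 := (hB.add_const (γ * ν⁻¹)).div_atTop Filter.tendsto_id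
  have key := (((hB.const_mul γ).const_add 1).const_mul 4).div
    ((hA2.const_add 2).mul (hB2.const_add 2)) (by norm_num)
  have e : (4 * (1 + γ * 0)) / ((2 + 0) * (2 + 0)) = (1 : ℝ) := by norm_num
  rw [e] at key
  refine key.congr' ?_
  filter_upwards [Filter.eventually_gt_atTop 0] with d hd
  simp only [id, Pi.div_apply]
  generalize Real.sqrt (d ^ 2 + ν⁻¹) * coth (Real.sqrt (d ^ 2 + ν⁻¹) * α) = P
  generalize Real.sqrt (d ^ 2 + ν⁻¹) * coth (Real.sqrt (d ^ 2 + ν⁻¹) * (T - α)) = Q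
  have e1 : 2 + (P - d) / d = (P + d) / d := by field_simp; ring
  have e2 : 2 + (Q - d + γ * ν⁻¹) / d = (Q + d + γ * ν⁻¹) / d := by
    generalize γ * ν⁻¹ = g
    field_simp; ring
  rw [e1, e2]
  generalize Q + d + γ * ν⁻¹ = R
  generalize P + d = S
  generalize 1 + γ * (Q - d) = N
  rw [div_mul_div_comm, div_div_eq_mul_div, mul_assoc ν S R]
  rw [← mul_div_assoc, show 4 * ν * d ^ 2 * N = ν * (4 * N * (d * d)) by ring,
    mul_div_mul_left _ _ hν.ne']
end

section
/- Let ν > 0, 0 < α < T, and 0 ≤ d_min ≤ d be real numbers. With σ(s) = √(s² + ν⁻¹) for s ≥ 0 and σ_min = σ(d_min), one has 1 / (ν·(σ(d)·tanh(σ(d)·α) + d)·(σ(d)·tanh(σ(d)·(T − α)) + d)) ≤ 1 / (ν·(σ_min·tanh(σ_min·α) + d_min)·(σ_min·tanh(σ_min·(T − α)) + d_min)). -/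
theorem tanh_mono_aux {x y : ℝ} (h : x ≤ y) : Real.tanh x ≤ Real.tanh y := by
  rw [Real.tanh_eq_sinh_div_cosh, Real.tanh_eq_sinh_div_cosh,
    div_le_div_iff₀ (Real.cosh_pos x) (Real.cosh_pos y)]
  have h1 : 0 ≤ Real.sinh (y - x) := Real.sinh_nonneg_iff.2 (sub_nonneg.2 h)
  rw [Real.sinh_sub] at h1
  linarith

theorem tanh_pos_aux {x : ℝ} (h : 0 < x) : 0 < Real.tanh x := by
  rw [Real.tanh_eq_sinh_div_cosh]
  exact div_pos (Real.sinh_pos_iff.2 h) (Real.cosh_pos x)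

theorem sn1_factor_estimate (ν α T dmin d : ℝ) (hν : 0 < ν) (hα : 0 < α) (hαT : α < T)
    (hdmin : 0 ≤ dmin) (hd : dmin ≤ d) :
    1 / (ν * (Real.sqrt (d ^ 2 + ν⁻¹) * Real.tanh (Real.sqrt (d ^ 2 + ν⁻¹) * α) + d) *
        (Real.sqrt (d ^ 2 + ν⁻¹) * Real.tanh (Real.sqrt (d ^ 2 + ν⁻¹) * (T - α)) + d)) ≤
      1 / (ν * (Real.sqrt (dmin ^ 2 + ν⁻¹) * Real.tanh (Real.sqrt (dmin ^ 2 + ν⁻¹) * α) + dmin) *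
        (Real.sqrt (dmin ^ 2 + ν⁻¹) * Real.tanh (Real.sqrt (dmin ^ 2 + ν⁻¹) * (T - α)) + dmin)) := by
  have hs : 0 < Real.sqrt (dmin ^ 2 + ν⁻¹) := Real.sqrt_pos.2 (by positivity)
  have hst : Real.sqrt (dmin ^ 2 + ν⁻¹) ≤ Real.sqrt (d ^ 2 + ν⁻¹) :=
    Real.sqrt_le_sqrt (by gcongr)
  generalize Real.sqrt (dmin ^ 2 + ν⁻¹) = s at *
  generalize Real.sqrt (d ^ 2 + ν⁻¹) = t at *
  have key : ∀ a : ℝ, 0 < a → 0 < s * Real.tanh (s * a) + dmin ∧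
      s * Real.tanh (s * a) + dmin ≤ t * Real.tanh (t * a) + d := by
    intro a ha
    have h1 : 0 < Real.tanh (s * a) := tanh_pos_aux (mul_pos hs ha)
    have h2 : Real.tanh (s * a) ≤ Real.tanh (t * a) :=
      tanh_mono_aux (mul_le_mul_of_nonneg_right hst ha.le)
    refine ⟨by positivity, add_le_add (mul_le_mul hst h2 h1.le (hs.le.trans hst)) hd⟩
  obtain ⟨p1, l1⟩ := key α hα
  obtain ⟨p2, l2⟩ := key (T - α) (sub_pos.2 hαT)
  apply one_div_le_one_div_of_le (mul_pos (mul_pos hν p1) p2)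
  exact mul_le_mul (mul_le_mul_of_nonneg_left l1 hν.le) l2 p2.le
    (mul_nonneg hν.le (p1.le.trans l1))
end

section
/- Let ν > 0 and 0 < α < T. The function g : [0, ∞) → ℝ defined by g(d) = 1 / (ν·(σ(d)·tanh(σ(d)·α) + d)·(σ(d)·tanh(σ(d)·(T − α)) + d)), where σ(d) = √(d² + ν⁻¹), is strictly decreasing on [0, ∞). -/
theorem aux_tanh_mono {a b : ℝ} (h : a ≤ b) : Real.tanh a ≤ Real.tanh b := by
  rw [Real.tanh_eq_sinh_div_cosh, Real.tanh_eq_sinh_div_cosh,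
    div_le_div_iff₀ (Real.cosh_pos a) (Real.cosh_pos b)]
  have h1 : 0 ≤ Real.sinh (b - a) := Real.sinh_nonneg_iff.2 (by linarith)
  rw [Real.sinh_sub] at h1
  linarith

theorem aux_tanh_pos {a : ℝ} (h : 0 < a) : 0 < Real.tanh a := by
  rw [Real.tanh_eq_sinh_div_cosh]
  exact div_pos (Real.sinh_pos_iff.2 h) (Real.cosh_pos a)

theorem aux_factor {ν c x y : ℝ} (hν : 0 < ν) (hc : 0 < c) (hx : 0 ≤ x) (hxy : x < y) :
    0 < Real.sqrt (x ^ 2 + ν⁻¹) * Real.tanh (Real.sqrt (x ^ 2 + ν⁻¹) * c) + x ∧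
    Real.sqrt (x ^ 2 + ν⁻¹) * Real.tanh (Real.sqrt (x ^ 2 + ν⁻¹) * c) + x <
    Real.sqrt (y ^ 2 + ν⁻¹) * Real.tanh (Real.sqrt (y ^ 2 + ν⁻¹) * c) + y := by
  have hs : 0 < Real.sqrt (x ^ 2 + ν⁻¹) := Real.sqrt_pos.2 (by positivity)
  have hst : Real.sqrt (x ^ 2 + ν⁻¹) ≤ Real.sqrt (y ^ 2 + ν⁻¹) :=
    Real.sqrt_le_sqrt (by gcongr)
  have ht := aux_tanh_pos (mul_pos hs hc)
  have hm := aux_tanh_mono (mul_le_mul_of_nonneg_right hst hc.le)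
  refine ⟨by positivity, ?_⟩
  have := mul_le_mul hst hm ht.le (hs.le.trans hst)
  linarith

theorem sn1_factor_strictAnti (ν α T : ℝ) (hν : 0 < ν) (hα : 0 < α) (hαT : α < T) :
    StrictAntiOn (fun d : ℝ =>
      1 / (ν * (Real.sqrt (d ^ 2 + ν⁻¹) * Real.tanh (Real.sqrt (d ^ 2 + ν⁻¹) * α) + d) *
        (Real.sqrt (d ^ 2 + ν⁻¹) * Real.tanh (Real.sqrt (d ^ 2 + ν⁻¹) * (T - α)) + d)))
      (Set.Ici 0) := by
  intro x hx y _ hxy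
  obtain ⟨p1, l1⟩ := aux_factor hν hα hx hxy
  obtain ⟨p2, l2⟩ := aux_factor hν (sub_pos.2 hαT) hx hxy
  exact one_div_lt_one_div_of_lt (mul_pos (mul_pos hν p1) p2)
    (mul_lt_mul'' (mul_lt_mul_of_pos_left l1 hν) l2 (mul_pos hν p1).le p2.le)
end

section
/- Let ν > 0, γ ≥ 0 and 0 < α < T be fixed. Define for d > 0: ρ(d) = (1 + γ(σ(d)·tanh(σ(d)·(T − α)) − d)) / (ν·(σ(d)·tanh(σ(d)·α) + d)·(σ(d)·tanh(σ(d)·(T − α)) + d + γ·ν⁻¹)), where σ(d) = √(d² + ν⁻¹). Then 4·ν·d²·ρ(d) tends to 1 as d → ∞. -/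
theorem aux_tanh : Filter.Tendsto (fun x : ℝ => x * (1 - Real.tanh x)) Filter.atTop (nhds 0) := by
  have h := Real.tendsto_pow_mul_exp_neg_atTop_nhds_zero 1
  have key : ∀ x : ℝ, 1 - Real.tanh x = Real.exp (-x) / Real.cosh x := by
    intro x
    have hc := (Real.cosh_pos x).ne'
    rw [Real.tanh_eq_sinh_div_cosh, ← Real.cosh_sub_sinh]
    field_simp
  refine tendsto_of_tendsto_of_tendsto_of_le_of_le' tendsto_const_nhds h ?_ ?_
  · filter_upwards [Filter.eventually_ge_atTop 0] with x hx
    rw [key]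
    have hc := Real.cosh_pos x
    positivity
  · filter_upwards [Filter.eventually_ge_atTop 0] with x hx
    rw [key, pow_one]
    exact mul_le_mul_of_nonneg_left
      (div_le_self (Real.exp_pos _).le (Real.one_le_cosh x)) hx

theorem aux_g (c a : ℝ) (hc : 0 < c) (ha : 0 < a) :
    Filter.Tendsto (fun d : ℝ => Real.sqrt (d ^ 2 + c) * Real.tanh (Real.sqrt (d ^ 2 + c) * a) - d)
      Filter.atTop (nhds 0) := by
  have h1 : Filter.Tendsto (fun d : ℝ => Real.sqrt (d ^ 2 + c) - d) Filter.atTop (nhds 0) := by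
    have h : Filter.Tendsto (fun d : ℝ => c / d) Filter.atTop (nhds 0) :=
      tendsto_const_nhds.div_atTop Filter.tendsto_id
    refine tendsto_of_tendsto_of_tendsto_of_le_of_le' tendsto_const_nhds h ?_ ?_
    · filter_upwards [Filter.eventually_gt_atTop 0] with d hd
      have : d ≤ Real.sqrt (d ^ 2 + c) := Real.le_sqrt_of_sq_le (by linarith)
      linarith
    · filter_upwards [Filter.eventually_gt_atTop 0] with d hd
      have hcd : 0 < c / d := by positivity
      have e : d * (c / d) = c := by field_simp
      have : Real.sqrt (d ^ 2 + c) ≤ d + c / d :=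
        Real.sqrt_le_iff.2 ⟨by positivity, by nlinarith⟩
      linarith
  have hs : Filter.Tendsto (fun d : ℝ => Real.sqrt (d ^ 2 + c) * a) Filter.atTop Filter.atTop := by
    refine Filter.Tendsto.atTop_mul_const ha ?_
    refine Filter.tendsto_atTop_mono (fun d => ?_) Filter.tendsto_id
    exact Real.le_sqrt_of_sq_le (by simp only [id]; linarith)
  have h2 := (aux_tanh.comp hs).const_mul a⁻¹
  have h3 := h1.sub h2
  rw [mul_zero, sub_zero] at h3
  refine h3.congr (fun d => ?_)
  simp only [Function.comp]
  field_simp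
  ring

theorem sn1_factor_asymptotic (ν γ α T : ℝ) (hν : 0 < ν) (hγ : 0 ≤ γ)
    (hα : 0 < α) (hαT : α < T) :
    Filter.Tendsto (fun d : ℝ =>
      4 * ν * d ^ 2 *
        ((1 + γ * (Real.sqrt (d ^ 2 + ν⁻¹) * Real.tanh (Real.sqrt (d ^ 2 + ν⁻¹) * (T - α)) - d)) /
          (ν * (Real.sqrt (d ^ 2 + ν⁻¹) * Real.tanh (Real.sqrt (d ^ 2 + ν⁻¹) * α) + d) *
            (Real.sqrt (d ^ 2 + ν⁻¹) * Real.tanh (Real.sqrt (d ^ 2 + ν⁻¹) * (T - α)) + d + γ * ν⁻¹))))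
      Filter.atTop (nhds 1) := by
  have g1 := aux_g ν⁻¹ α (inv_pos.2 hν) hα
  have g2 := aux_g ν⁻¹ (T - α) (inv_pos.2 hν) (sub_pos.2 hαT)
  have q1 := (g1.div_atTop Filter.tendsto_id).add_const 2
  have q2 := ((g2.add_const (γ * ν⁻¹)).div_atTop Filter.tendsto_id).add_const 2
  have n := ((g2.const_mul γ).const_add 1).const_mul 4
  have r := n.div (q1.mul q2) (by norm_num)
  have e : (4 * (1 + γ * 0)) / ((0 + 2) * (0 + 2)) = (1 : ℝ) := by norm_num
  rw [e] at r
  refine r.congr' ?_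
  filter_upwards [Filter.eventually_gt_atTop 0] with d hd
  simp only [id, Pi.div_apply]
  generalize Real.sqrt (d ^ 2 + ν⁻¹) * Real.tanh (Real.sqrt (d ^ 2 + ν⁻¹) * (T - α)) = x
  generalize Real.sqrt (d ^ 2 + ν⁻¹) * Real.tanh (Real.sqrt (d ^ 2 + ν⁻¹) * α) = y
  have ey : (y - d) / d + 2 = (y + d) / d := by field_simp; ring
  have ex : (x - d + γ * ν⁻¹) / d + 2 = (x + d + γ * ν⁻¹) / d := by field_simp; ring
  rw [ey, ex]
  generalize x + d + γ * ν⁻¹ = X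
  generalize y + d = Y
  rw [div_mul_div_comm, div_div_eq_mul_div, mul_assoc ν Y X, ← mul_div_assoc,
    show 4 * ν * d ^ 2 * (1 + γ * (x - d)) = ν * (4 * (1 + γ * (x - d)) * (d * d)) by ring,
    mul_div_mul_left _ _ hν.ne']
end

section
/- Let f₀ > 0 be a real number and set θ* = 2 / (2 + f₀). Then: (a) for every f with 0 ≤ f ≤ f₀, |1 − θ*·(1 + f)| ≤ f₀ / (2 + f₀); and (b) for every real θ, max(|1 − θ|, |1 − θ·(1 + f₀)|) ≥ f₀ / (2 + f₀). -/
theorem equioscillation (f₀ : ℝ) (hf₀ : 0 < f₀) :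
    (∀ f : ℝ, 0 ≤ f → f ≤ f₀ →
      |1 - 2 / (2 + f₀) * (1 + f)| ≤ f₀ / (2 + f₀)) ∧
    (∀ θ : ℝ, f₀ / (2 + f₀) ≤ max |1 - θ| |1 - θ * (1 + f₀)|) := by
  have hp : 0 < 2 + f₀ := by linarith
  constructor
  · intro f h0 h1
    have e : 1 - 2 / (2 + f₀) * (1 + f) = (f₀ - 2 * f) / (2 + f₀) := by
      field_simp
      ring
    rw [e, abs_div, abs_of_pos hp]
    apply div_le_div_of_nonneg_right _ hp.le
    rw [abs_le]
    constructor <;> linarith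
  · intro θ
    rw [div_le_iff₀ hp]
    have h1 := (le_abs_self (1 - θ)).trans (le_max_left |1 - θ| |1 - θ * (1 + f₀)|)
    have h2 := (neg_le_abs (1 - θ * (1 + f₀))).trans (le_max_right |1 - θ| |1 - θ * (1 + f₀)|)
    have h3 := mul_le_mul_of_nonneg_left h1 (by linarith : 0 ≤ 1 + f₀)
    linarith
end

section
/- Let σ > 0 and α < T be real numbers, and let z, z' : ℝ → ℝ be functions such that z has derivative z'(t) at every t ∈ ℝ, z' has derivative σ²·z(t) at every t ∈ ℝ (i.e., z'' = σ²z), and z(T) = 0. Then z'(α) = −σ·coth(σ·(T − α))·z(α). -/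
theorem ode_robin_right (σ α T : ℝ) (hσ : 0 < σ) (hαT : α < T) (z z' : ℝ → ℝ)
    (hz : ∀ t : ℝ, HasDerivAt z (z' t) t)
    (hz' : ∀ t : ℝ, HasDerivAt z' (σ ^ 2 * z t) t)
    (hT : z T = 0) :
    z' α = -(σ * coth (σ * (T - α))) * z α := by
  have hl : ∀ t : ℝ, HasDerivAt (fun t => σ * (T - t)) (-σ) t := fun t => by
    simpa using ((hasDerivAt_id t).const_sub T).const_mul σ
  have hW : ∀ t : ℝ, HasDerivAt (fun t => z' t * Real.sinh (σ * (T - t))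
      + σ * (z t * Real.cosh (σ * (T - t)))) 0 t := fun t => by
    have h := ((hz' t).mul (hl t).sinh).add (((hz t).mul (hl t).cosh).const_mul σ)
    refine h.congr_deriv ?_
    ring
  have hc := is_const_of_deriv_eq_zero (fun t => (hW t).differentiableAt)
    (fun t => (hW t).deriv) α T
  simp [hT] at hc
  have hs : 0 < Real.sinh (σ * (T - α)) :=
    Real.sinh_pos_iff.2 (mul_pos hσ (sub_pos.2 hαT))
  have hne := hs.ne'
  unfold coth
  field_simp
  linarith
end
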